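/- For each of the eight cluster variables θ ∈ {θ₁, θ₁₂, θ₂, θ₂₃, θ₃, θ₃₄, θ₄, θ₄₁}, the extension of the ideal I_{G₂} in the localization of R₁₈ away from θ (denominators powers of θ) is generated by six elements; that is, on each open set (θ ≠ 0) the cluster variety X_{G₂} is a complete intersection of codimension 6. -/

import Mathlib

/-!
The G₂ cluster variety.

`R18` is the polynomial ring over ℂ in the 18 variables, indexed as follows:
`0 ↦ θ₁, 1 ↦ θ₁₂, 2 ↦ θ₂, 3 ↦ θ₂₃, 4 ↦ θ₃, 5 ↦ θ₃₄, 6 ↦ θ₄, 7 ↦ θ₄₁,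
 8 ↦ A₁, 9 ↦ A₁₂, 10 ↦ A₂, 11 ↦ A₂₃, 12 ↦ A₃, 13 ↦ A₃₄, 14 ↦ A₄, 15 ↦ A₄₁,
 16 ↦ λ₁₃, 17 ↦ λ₂₄`.
Indices `i : Fin 4` stand for the indices 1,2,3,4 taken modulo 4, with `Fin 4` addition.
-/

open MvPolynomial

noncomputable section

abbrev R18 : Type := MvPolynomial (Fin 18) ℂ

/-- The cluster variables θ₁, θ₂, θ₃, θ₄. -/
def th : Fin 4 → R18 := ![X 0, X 2, X 4, X 6]

/-- The cluster variables θ₁₂, θ₂₃, θ₃₄, θ₄₁ : `thp i = θ_{i,i+1}`. -/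
def thp : Fin 4 → R18 := ![X 1, X 3, X 5, X 7]

/-- The coefficients A₁, A₂, A₃, A₄. -/
def aS : Fin 4 → R18 := ![X 8, X 10, X 12, X 14]

/-- The coefficients A₁₂, A₂₃, A₃₄, A₄₁ : `aP i = A_{i,i+1}`. -/
def aP : Fin 4 → R18 := ![X 9, X 11, X 13, X 15]

/-- The parameters: `lam i = λ_{i,i+2}`, so `λ₁₃ = lam 0 = lam 2` and
`λ₂₄ = lam 1 = lam 3` (unordered pairs of opposite indices). -/
def lam : Fin 4 → R18 := ![X 16, X 17, X 16, X 17]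

/-- `θ_{xy}` for *adjacent* `x y : Fin 4` (unordered pair: `θ_{xy} = θ_{yx}`). -/
def thpp (x y : Fin 4) : R18 := if y = x + 1 then thp x else thp y

/-- `A_{xy}` for *adjacent* `x y : Fin 4` (unordered pair: `A_{xy} = A_{yx}`). -/
def aPP (x y : Fin 4) : R18 := if y = x + 1 then aP x else aP y

/-- The dihedral permutation `(i,j,k,l)` of `(1,2,3,4)` starting at `s` with direction `d`:
position `t` is sent to `s + t` (if `d`) or `s - t` (otherwise). The eight choices of
`(s, d)` give the eight dihedral permutations (cyclic rotations and their reversals). -/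
def dih (s : Fin 4) (d : Bool) (t : Fin 4) : Fin 4 := if d then s + t else s - t

/-- Family 1: `θᵢθⱼ − A_{ij}θ_{ij} − A_{jk}A_kA_{kl}²A_lA_{li}` (4 distinct equations). -/
def f1 (s : Fin 4) (d : Bool) : R18 :=
  let i := dih s d 0; let j := dih s d 1; let k := dih s d 2; let l := dih s d 3
  th i * th j - aPP i j * thpp i j - aPP j k * aS k * aPP k l ^ 2 * aS l * aPP l i

/-- Family 2: `θ_{ij}θ_{jk} − A_jθⱼ³ − λ_{jl}A_{kl}A_{li}θⱼ² − λ_{ik}A_{kl}²A_lA_{li}²θⱼ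
− A_kA_{kl}³A_l²A_{li}³A_i` (4 distinct equations). -/
def f2 (s : Fin 4) (d : Bool) : R18 :=
  let i := dih s d 0; let j := dih s d 1; let k := dih s d 2; let l := dih s d 3
  thpp i j * thpp j k - aS j * th j ^ 3 - lam j * aPP k l * aPP l i * th j ^ 2
    - lam i * aPP k l ^ 2 * aS l * aPP l i ^ 2 * th j
    - aS k * aPP k l ^ 3 * aS l ^ 2 * aPP l i ^ 3 * aS i

/-- Family 3: `θᵢθ_{jk} − A_{ij}A_jθⱼ² − λ_{jl}A_{kl}A_{li}A_{ij}θⱼ − λ_{ik}A_{kl}²A_lA_{li}²A_{ij}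
− A_kA_{kl}²A_lA_{li}θ_k` (8 distinct equations). -/
def f3 (s : Fin 4) (d : Bool) : R18 :=
  let i := dih s d 0; let j := dih s d 1; let k := dih s d 2; let l := dih s d 3
  th i * thpp j k - aPP i j * aS j * th j ^ 2 - lam j * aPP k l * aPP l i * aPP i j * th j
    - lam i * aPP k l ^ 2 * aS l * aPP l i ^ 2 * aPP i j
    - aS k * aPP k l ^ 2 * aS l * aPP l i * th k

/-- Family 4: `θᵢθ_k − A_{ij}A_jA_{jk}θⱼ − λ_{jl}A_{ij}A_{jk}A_{kl}A_{li} − A_{kl}A_lA_{li}θ_l`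
(2 distinct equations). -/
def f4 (s : Fin 4) (d : Bool) : R18 :=
  let i := dih s d 0; let j := dih s d 1; let k := dih s d 2; let l := dih s d 3
  th i * th k - aPP i j * aS j * aPP j k * th j
    - lam j * aPP i j * aPP j k * aPP k l * aPP l i - aPP k l * aS l * aPP l i * th l

/-- Family 5: `θ_{ij}θ_{kl} − A_jA_{jk}²A_kθⱼθ_k − A_{li}A_{jk}(λ_{ik}θᵢθ_k + λ_{jl}θⱼθ_l)
− A_lA_{li}²A_iθ_lθᵢ − A_{ij}A_{jk}²A_{kl}A_{li}²(A_iA_jA_kA_l − λ_{ik}λ_{jl})`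
(2 distinct equations). -/
def f5 (s : Fin 4) (d : Bool) : R18 :=
  let i := dih s d 0; let j := dih s d 1; let k := dih s d 2; let l := dih s d 3
  thpp i j * thpp k l - aS j * aPP j k ^ 2 * aS k * th j * th k
    - aPP l i * aPP j k * (lam i * th i * th k + lam j * th j * th l)
    - aS l * aPP l i ^ 2 * aS i * th l * th i
    - aPP i j * aPP j k ^ 2 * aPP k l * aPP l i ^ 2
        * (aS i * aS j * aS k * aS l - lam i * lam j)

/-- All the generators of the G₂ cluster ideal, indexed by the family (`Fin 5`) and the
dihedral permutation (`Fin 4 × Bool`).  As permutations in the same dihedral orbit of an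
equation give the same polynomial, the set of values of this family consists of the twenty
defining polynomials (4 + 4 + 8 + 2 + 2). -/
def genG2 : Fin 5 → Fin 4 → Bool → R18 := ![f1, f2, f3, f4, f5]

/-- The G₂ cluster ideal, generated by the twenty relations. -/
def IG2 : Ideal R18 :=
  Ideal.span (Set.range (fun x : Fin 5 × Fin 4 × Bool => genG2 x.1 x.2.1 x.2.2))

/-- The G₂ cluster variety `X_{G₂} ⊆ ℂ¹⁸`: the common zero locus of the twenty generators. -/
def XG2 : Set (Fin 18 → ℂ) :=
  {p | ∀ (m : Fin 5) (s : Fin 4) (d : Bool), eval p (genG2 m s d) = 0}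

/-- The eight cluster variables θ₁, θ₁₂, θ₂, θ₂₃, θ₃, θ₃₄, θ₄, θ₄₁. -/
def clusterVar : Fin 8 → R18 := ![X 0, X 1, X 2, X 3, X 4, X 5, X 6, X 7]

end

/-- The twenty relations of the G₂ cluster ideal for four cyclically indexed families of elements
of a commutative ring; `l s` stands for `λ_{s,s+2}`. -/
structure IsG2Point {K : Type*} [CommRing K] (t p a b l : Fin 4 → K) : Prop where
  one (s : Fin 4) :
    t s * t (s + 1) = b s * p s + b (s + 1) * a (s + 2) * b (s + 2) ^ 2 * a (s + 3) * b (s + 3)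
  two (s : Fin 4) :
    p s * p (s + 1) = a (s + 1) * t (s + 1) ^ 3 +
      l (s + 1) * b (s + 2) * b (s + 3) * t (s + 1) ^ 2 +
      l s * b (s + 2) ^ 2 * a (s + 3) * b (s + 3) ^ 2 * t (s + 1) +
      a (s + 2) * b (s + 2) ^ 3 * a (s + 3) ^ 2 * b (s + 3) ^ 3 * a s
  three (s : Fin 4) :
    t s * p (s + 1) = b s * a (s + 1) * t (s + 1) ^ 2 +
      l (s + 1) * b (s + 2) * b (s + 3) * b s * t (s + 1) +
      l s * b (s + 2) ^ 2 * a (s + 3) * b (s + 3) ^ 2 * b s +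
      a (s + 2) * b (s + 2) ^ 2 * a (s + 3) * b (s + 3) * t (s + 2)
  three_rev (s : Fin 4) :
    t s * p (s + 2) = b (s + 3) * a (s + 3) * t (s + 3) ^ 2 +
      l (s + 3) * b (s + 1) * b s * b (s + 3) * t (s + 3) +
      l s * b (s + 1) ^ 2 * a (s + 1) * b s ^ 2 * b (s + 3) +
      a (s + 2) * b (s + 1) ^ 2 * a (s + 1) * b s * t (s + 2)
  four (s : Fin 4) :
    t s * t (s + 2) = b s * a (s + 1) * b (s + 1) * t (s + 1) +
      l (s + 1) * b s * b (s + 1) * b (s + 2) * b (s + 3) +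
      b (s + 2) * a (s + 3) * b (s + 3) * t (s + 3)
  five (s : Fin 4) :
    p s * p (s + 2) = a (s + 1) * b (s + 1) ^ 2 * a (s + 2) * t (s + 1) * t (s + 2) +
      b (s + 3) * b (s + 1) * (l s * t s * t (s + 2) + l (s + 1) * t (s + 1) * t (s + 3)) +
      a (s + 3) * b (s + 3) ^ 2 * a s * t (s + 3) * t s +
      b s * b (s + 1) ^ 2 * b (s + 2) * b (s + 3) ^ 2 *
      (a s * a (s + 1) * a (s + 2) * a (s + 3) - l s * l (s + 1))

namespace IsG2Point

variable {K : Type*} [CommRing K] {t p a b : Fin 4 → K} {x y : K}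

/-- When `θ₁` is invertible, six of the relations imply the others. -/
theorem of_isUnit_t (hu : IsUnit (t 0))
    (h1_2 : t 0 * t 1 = b 0 * p 0 + b 1 * a 2 * b 2 ^ 2 * a 3 * b 3)
    (h4_1 : t 3 * t 0 = b 3 * p 3 + b 0 * a 1 * b 1 ^ 2 * a 2 * b 2)
    (h1_23 : t 0 * p 1 = b 0 * a 1 * t 1 ^ 2 + y * b 2 * b 3 * b 0 * t 1 +
        x * b 2 ^ 2 * a 3 * b 3 ^ 2 * b 0 + a 2 * b 2 ^ 2 * a 3 * b 3 * t 2)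
    (h1_34 : t 0 * p 2 = b 3 * a 3 * t 3 ^ 2 + y * b 1 * b 0 * b 3 * t 3 +
        x * b 1 ^ 2 * a 1 * b 0 ^ 2 * b 3 + a 2 * b 1 ^ 2 * a 1 * b 0 * t 2)
    (h1_3 : t 0 * t 2 = b 0 * a 1 * b 1 * t 1 + y * b 0 * b 1 * b 2 * b 3 +
        b 2 * a 3 * b 3 * t 3)
    (h41_12 : p 3 * p 0 = a 0 * t 0 ^ 3 + x * b 1 * b 2 * t 0 ^ 2 +
        y * b 1 ^ 2 * a 2 * b 2 ^ 2 * t 0 +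
        a 1 * b 1 ^ 3 * a 2 ^ 2 * b 2 ^ 3 * a 3) :
    IsG2Point t p a b ![x, y, x, y] := by
  have h2_41 : t 1 * p 3 = b 0 * a 0 * t 0 ^ 2 + x * b 2 * b 1 * b 0 * t 0 +
        y * b 2 ^ 2 * a 2 * b 1 ^ 2 * b 0 + a 3 * b 2 ^ 2 * a 2 * b 1 * t 3 :=
    hu.mul_left_cancel (by
      linear_combination
        (p 3) * h1_2 + (b 0) * h41_12 + (-b 1 * a 2 * b 2 ^ 2 * a 3) * h4_1)
  have h3_41 : t 2 * p 3 = b 2 * a 3 * t 3 ^ 2 + y * b 0 * b 1 * b 2 * t 3 +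
        x * b 0 ^ 2 * a 1 * b 1 ^ 2 * b 2 + a 0 * b 0 ^ 2 * a 1 * b 1 * t 0 :=
    hu.mul_left_cancel (by
      linear_combination
        (p 3) * h1_3 + (b 0 * a 1 * b 1) * h2_41 + (-t 3 * b 2 * a 3 -
          b 0 * b 1 * b 2 * y) * h4_1)
  have h4_12 : t 3 * p 0 = b 3 * a 0 * t 0 ^ 2 + x * b 1 * b 2 * b 3 * t 0 +
        y * b 1 ^ 2 * a 2 * b 2 ^ 2 * b 3 + a 1 * b 1 ^ 2 * a 2 * b 2 * t 1 :=
    hu.mul_left_cancel (by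
      linear_combination
        (p 0) * h4_1 + (b 3) * h41_12 + (-a 1 * b 1 ^ 2 * a 2 * b 2) * h1_2)
  have h2_4 : t 1 * t 3 = b 1 * a 2 * b 2 * t 2 + x * b 1 * b 2 * b 3 * b 0 +
        b 3 * a 0 * b 0 * t 0 :=
    hu.mul_left_cancel (by
      linear_combination
        (t 3) * h1_2 + (b 0) * h4_12 + (-b 1 * a 2 * b 2) * h1_3)
  have h2_3 : t 1 * t 2 = b 1 * p 1 + b 2 * a 3 * b 3 ^ 2 * a 0 * b 0 :=
    hu.mul_left_cancel (by
      linear_combination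
        (-b 1) * h1_23 + (t 1) * h1_3 + (b 2 * a 3 * b 3) * h2_4)
  have h3_4 : t 2 * t 3 = b 2 * p 2 + b 3 * a 0 * b 0 ^ 2 * a 1 * b 1 :=
    hu.mul_left_cancel (by
      linear_combination
        (t 2) * h4_1 + (-b 2) * h1_34 + (b 3) * h3_41)
  have h34_41 : p 2 * p 3 = a 3 * t 3 ^ 3 + y * b 0 * b 1 * t 3 ^ 2 +
        x * b 0 ^ 2 * a 1 * b 1 ^ 2 * t 3 +
        a 0 * b 0 ^ 3 * a 1 ^ 2 * b 1 ^ 3 * a 2 :=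
    hu.mul_left_cancel (by
      linear_combination
        (p 3) * h1_34 + (b 0 * a 1 * b 1 ^ 2 * a 2) * h3_41 + (-t 3 ^ 2 * a 3 -
          t 3 * b 0 * b 1 * y - b 0 ^ 2 * a 1 * b 1 ^ 2 * x) * h4_1)
  have h2_34 : t 1 * p 2 = b 1 * a 2 * t 2 ^ 2 + x * b 3 * b 0 * b 1 * t 2 +
        y * b 3 ^ 2 * a 0 * b 0 ^ 2 * b 1 + a 3 * b 3 ^ 2 * a 0 * b 0 * t 3 :=
    hu.mul_left_cancel (by
      linear_combination
        (-t 2 * b 1 * a 2 - b 0 * b 1 * b 3 * x) * h1_3 + (t 3 * a 3 * b 3 +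
          b 0 * b 1 * b 3 * y) * h2_4 + (t 1) * h1_34)
  have h3_12 : t 2 * p 0 = b 1 * a 1 * t 1 ^ 2 + y * b 3 * b 2 * b 1 * t 1 +
        x * b 3 ^ 2 * a 3 * b 2 ^ 2 * b 1 + a 0 * b 3 ^ 2 * a 3 * b 2 * t 0 :=
    hu.mul_left_cancel (by
      linear_combination
        (p 0) * h1_3 + (-t 1 * a 1 * b 1 - b 1 * b 2 * b 3 * y) * h1_2 +
          (b 2 * a 3 * b 3) * h4_12)
  have h4_23 : t 3 * p 1 = b 2 * a 2 * t 2 ^ 2 + x * b 0 * b 3 * b 2 * t 2 +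
        y * b 0 ^ 2 * a 0 * b 3 ^ 2 * b 2 + a 1 * b 0 ^ 2 * a 0 * b 3 * t 1 :=
    hu.mul_left_cancel (by
      linear_combination
        (-t 2 * a 2 * b 2 - b 0 * b 2 * b 3 * x) * h1_3 + (t 1 * b 0 * a 1 +
          b 0 * b 2 * b 3 * y) * h2_4 + (t 3) * h1_23)
  have h12_23 : p 0 * p 1 = a 1 * t 1 ^ 3 + y * b 2 * b 3 * t 1 ^ 2 +
        x * b 2 ^ 2 * a 3 * b 3 ^ 2 * t 1 +
        a 2 * b 2 ^ 3 * a 3 ^ 2 * b 3 ^ 3 * a 0 :=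
    hu.mul_left_cancel (by
      linear_combination
        (p 0) * h1_23 + (-t 1 ^ 2 * a 1 - t 1 * b 2 * b 3 * y -
          b 2 ^ 2 * a 3 * b 3 ^ 2 * x) * h1_2 + (a 2 * b 2 ^ 2 * a 3 * b 3) * h3_12)
  have h23_34 : p 1 * p 2 = a 2 * t 2 ^ 3 + x * b 3 * b 0 * t 2 ^ 2 +
        y * b 3 ^ 2 * a 0 * b 0 ^ 2 * t 2 +
        a 3 * b 3 ^ 3 * a 0 ^ 2 * b 0 ^ 3 * a 1 :=
    hu.mul_left_cancel (by
      linear_combination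
        (p 2) * h1_23 + (-t 2 ^ 2 * a 2 - t 2 * b 0 * b 3 * x -
          a 0 * b 0 ^ 2 * b 3 ^ 2 * y) * h1_3 + (t 1 * b 0 * a 1 +
          b 0 * b 2 * b 3 * y) * h2_34 + (a 0 * b 0 ^ 2 * a 1 * a 3 * b 3 ^ 2) * h2_4 +
          (-t 2 * a 2 * b 2 * a 3 * b 3 - b 0 * b 2 * a 3 * b 3 ^ 2 * x) * h3_4)
  have h12_34 : p 0 * p 2 = a 1 * b 1 ^ 2 * a 2 * t 1 * t 2 + b 3 * b 1 * (x * t 0 * t 2 +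
        y * t 1 * t 3) + a 3 * b 3 ^ 2 * a 0 * t 3 * t 0 +
        b 0 * b 1 ^ 2 * b 2 * b 3 ^ 2 * (a 0 * a 1 * a 2 * a 3 - x * y) :=
    hu.mul_left_cancel (by
      linear_combination
        (p 0) * h1_34 + (-t 0 * b 1 * b 3 * x) * h1_3 + (t 3 * a 3 * b 3) * h4_12 +
          (-b 0 * a 1 * b 1 ^ 2 * b 3 * x - t 3 * b 1 * b 3 * y -
          t 2 * a 1 * b 1 ^ 2 * a 2) * h1_2 + (a 1 * b 1 ^ 2 * a 2 * b 2 * a 3 * b 3) * h2_4)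
  have h23_41 : p 1 * p 3 = a 2 * b 2 ^ 2 * a 3 * t 2 * t 3 + b 0 * b 2 * (y * t 1 * t 3 +
        x * t 2 * t 0) + a 0 * b 0 ^ 2 * a 1 * t 0 * t 1 +
        b 1 * b 2 ^ 2 * b 3 * b 0 ^ 2 * (a 1 * a 2 * a 3 * a 0 - y * x) :=
    hu.mul_left_cancel (by
      linear_combination
        (p 3) * h1_23 + (t 1 * b 0 * a 1) * h2_41 + (-t 3 * a 2 * b 2 ^ 2 * a 3 -
          t 0 * b 0 * b 2 * x) * h1_3 + (a 2 * b 2 ^ 2 * a 3 * b 3) * h3_41 +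
          (-t 1 * b 0 * b 2 * y - b 0 * b 2 ^ 2 * a 3 * b 3 * x) * h4_1)
  have h3_1 : t 2 * t 0 = b 2 * a 3 * b 3 * t 3 + y * b 2 * b 3 * b 0 * b 1 +
        b 0 * a 1 * b 1 * t 1 := by
    linear_combination h1_3
  have h4_2 : t 3 * t 1 = b 3 * a 0 * b 0 * t 0 + x * b 3 * b 0 * b 1 * b 2 +
        b 1 * a 2 * b 2 * t 2 := by
    linear_combination h2_4
  have h34_12 : p 2 * p 0 = a 3 * b 3 ^ 2 * a 0 * t 3 * t 0 + b 1 * b 3 * (x * t 2 * t 0 +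
        y * t 3 * t 1) + a 1 * b 1 ^ 2 * a 2 * t 1 * t 2 +
        b 2 * b 3 ^ 2 * b 0 * b 1 ^ 2 * (a 2 * a 3 * a 0 * a 1 - x * y) := by
    linear_combination h12_34
  have h41_23 : p 3 * p 1 = a 0 * b 0 ^ 2 * a 1 * t 0 * t 1 + b 2 * b 0 * (y * t 3 * t 1 +
        x * t 0 * t 2) + a 2 * b 2 ^ 2 * a 3 * t 2 * t 3 +
        b 3 * b 0 ^ 2 * b 1 * b 2 ^ 2 * (a 3 * a 0 * a 1 * a 2 - y * x) := by
    linear_combination h23_41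
  constructor <;> intro s <;> fin_cases s
  exacts [h1_2, h2_3, h3_4, h4_1, h12_23, h23_34, h34_41, h41_12, h1_23, h2_34, h3_41, h4_12, h1_34,
      h2_41, h3_12, h4_23, h1_3, h2_4, h3_1, h4_2, h12_34, h23_41, h34_12, h41_23]

/-- When `θ₁₂` is invertible, six of the relations imply the others. -/
theorem of_isUnit_p (hu : IsUnit (p 0))
    (h12_23 : p 0 * p 1 = a 1 * t 1 ^ 3 + y * b 2 * b 3 * t 1 ^ 2 +
        x * b 2 ^ 2 * a 3 * b 3 ^ 2 * t 1 +
        a 2 * b 2 ^ 3 * a 3 ^ 2 * b 3 ^ 3 * a 0)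
    (h41_12 : p 3 * p 0 = a 0 * t 0 ^ 3 + x * b 1 * b 2 * t 0 ^ 2 +
        y * b 1 ^ 2 * a 2 * b 2 ^ 2 * t 0 +
        a 1 * b 1 ^ 3 * a 2 ^ 2 * b 2 ^ 3 * a 3)
    (h1_2 : t 0 * t 1 = b 0 * p 0 + b 1 * a 2 * b 2 ^ 2 * a 3 * b 3)
    (h3_12 : t 2 * p 0 = b 1 * a 1 * t 1 ^ 2 + y * b 3 * b 2 * b 1 * t 1 +
        x * b 3 ^ 2 * a 3 * b 2 ^ 2 * b 1 + a 0 * b 3 ^ 2 * a 3 * b 2 * t 0)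
    (h4_12 : t 3 * p 0 = b 3 * a 0 * t 0 ^ 2 + x * b 1 * b 2 * b 3 * t 0 +
        y * b 1 ^ 2 * a 2 * b 2 ^ 2 * b 3 + a 1 * b 1 ^ 2 * a 2 * b 2 * t 1)
    (h12_34 : p 0 * p 2 = a 1 * b 1 ^ 2 * a 2 * t 1 * t 2 + b 3 * b 1 * (x * t 0 * t 2 +
        y * t 1 * t 3) + a 3 * b 3 ^ 2 * a 0 * t 3 * t 0 +
        b 0 * b 1 ^ 2 * b 2 * b 3 ^ 2 * (a 0 * a 1 * a 2 * a 3 - x * y)) :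
    IsG2Point t p a b ![x, y, x, y] := by
  have h2_3 : t 1 * t 2 = b 1 * p 1 + b 2 * a 3 * b 3 ^ 2 * a 0 * b 0 :=
    hu.mul_left_cancel (by
      linear_combination
        (t 1) * h3_12 + (a 0 * b 2 * a 3 * b 3 ^ 2) * h1_2 + (-b 1) * h12_23)
  have h4_1 : t 3 * t 0 = b 3 * p 3 + b 0 * a 1 * b 1 ^ 2 * a 2 * b 2 :=
    hu.mul_left_cancel (by
      linear_combination
        (t 0) * h4_12 + (-b 3) * h41_12 + (a 1 * b 1 ^ 2 * a 2 * b 2) * h1_2)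
  have h1_23 : t 0 * p 1 = b 0 * a 1 * t 1 ^ 2 + y * b 2 * b 3 * b 0 * t 1 +
        x * b 2 ^ 2 * a 3 * b 3 ^ 2 * b 0 + a 2 * b 2 ^ 2 * a 3 * b 3 * t 2 :=
    hu.mul_left_cancel (by
      linear_combination
        (t 0) * h12_23 + (t 1 ^ 2 * a 1 + b 2 ^ 2 * a 3 * b 3 ^ 2 * x +
          t 1 * b 2 * b 3 * y) * h1_2 + (-a 2 * b 2 ^ 2 * a 3 * b 3) * h3_12)
  have h2_41 : t 1 * p 3 = b 0 * a 0 * t 0 ^ 2 + x * b 2 * b 1 * b 0 * t 0 +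
        y * b 2 ^ 2 * a 2 * b 1 ^ 2 * b 0 + a 3 * b 2 ^ 2 * a 2 * b 1 * t 3 :=
    hu.mul_left_cancel (by
      linear_combination
        (t 1) * h41_12 + (-b 1 * a 2 * b 2 ^ 2 * a 3) * h4_12 + (t 0 ^ 2 * a 0 +
          t 0 * b 1 * b 2 * x + b 1 ^ 2 * a 2 * b 2 ^ 2 * y) * h1_2)
  have h1_3 : t 0 * t 2 = b 0 * a 1 * b 1 * t 1 + y * b 0 * b 1 * b 2 * b 3 +
        b 2 * a 3 * b 3 * t 3 :=
    hu.mul_left_cancel (by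
      linear_combination
        (t 0) * h3_12 + (t 1 * a 1 * b 1 + b 1 * b 2 * b 3 * y) * h1_2 +
          (-b 2 * a 3 * b 3) * h4_12)
  have h2_4 : t 1 * t 3 = b 1 * a 2 * b 2 * t 2 + x * b 1 * b 2 * b 3 * b 0 +
        b 3 * a 0 * b 0 * t 0 :=
    hu.mul_left_cancel (by
      linear_combination
        (t 1) * h4_12 + (b 1 * b 2 * b 3 * x + t 0 * a 0 * b 3) * h1_2 +
          (-b 1 * a 2 * b 2) * h3_12)
  have h3_4 : t 2 * t 3 = b 2 * p 2 + b 3 * a 0 * b 0 ^ 2 * a 1 * b 1 :=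
    hu.mul_left_cancel (by
      linear_combination
        (-b 2) * h12_34 + (t 0 * a 0 * b 3) * h1_3 + (t 2) * h4_12 +
          (a 0 * b 0 * a 1 * b 1 * b 3) * h1_2 + (-b 1 * b 2 * b 3 * y) * h2_4)
  have h23_34 : p 1 * p 2 = a 2 * t 2 ^ 3 + x * b 3 * b 0 * t 2 ^ 2 +
        y * b 3 ^ 2 * a 0 * b 0 ^ 2 * t 2 +
        a 3 * b 3 ^ 3 * a 0 ^ 2 * b 0 ^ 3 * a 1 :=
    hu.mul_left_cancel (by
      linear_combination
        (-t 2 ^ 2 * a 2 - t 2 * b 0 * b 3 * x) * h3_12 + (t 2 * a 0 * b 0 * b 3 ^ 2 * y +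
          a 0 ^ 2 * b 0 ^ 2 * a 1 * a 3 * b 3 ^ 3) * h1_2 + (-t 1 * t 2 * a 1 * b 1 * a 2 -
          a 0 * b 0 * a 1 * b 1 * a 2 * b 2 * a 3 * b 3 ^ 2 - t 0 * a 0 * b 0 * b 3 ^ 2 * y -
          t 2 * b 1 * a 2 * b 2 * b 3 * y) * h2_3 + (p 1) * h12_34 + (t 2 * b 1 * b 3 * x +
          t 3 * a 0 * a 3 * b 3 ^ 2) * h1_23 + (p 1 * b 1 * b 3 * y +
          t 1 * a 0 * b 0 * a 1 * a 3 * b 3 ^ 2 + a 0 * b 0 * b 2 * a 3 * b 3 ^ 3 * y) * h2_4 +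
          (-t 2 * a 0 * a 2 * b 2 * a 3 * b 3 ^ 2 - a 0 * b 0 * b 2 * a 3 * b 3 ^ 3 * x) * h1_3)
  have h34_41 : p 2 * p 3 = a 3 * t 3 ^ 3 + y * b 0 * b 1 * t 3 ^ 2 +
        x * b 0 ^ 2 * a 1 * b 1 ^ 2 * t 3 +
        a 0 * b 0 ^ 3 * a 1 ^ 2 * b 1 ^ 3 * a 2 :=
    hu.mul_left_cancel (by
      linear_combination
        (-t 3 ^ 2 * a 3 - b 0 ^ 2 * a 1 * b 1 ^ 2 * x - t 3 * b 0 * b 1 * y) * h4_12 +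
          (-t 0 * t 3 * a 0 * a 3 * b 3 - a 0 * b 0 * a 1 * b 1 ^ 2 * a 2 * b 2 * a 3 * b 3 -
          t 3 * b 1 * b 2 * a 3 * b 3 * x) * h4_1 + (-t 3 * a 1 * b 1 ^ 2 * a 2 * b 2 * a 3 -
          b 0 * a 1 * b 1 ^ 3 * a 2 * b 2 * y) * h2_4 + (t 3 * b 1 * b 3 * y +
          t 2 * a 1 * b 1 ^ 2 * a 2 + b 0 * a 1 * b 1 ^ 2 * b 3 * x) * h2_41 +
          (t 0 * a 0 * b 0 * a 1 * b 1 ^ 2 * a 2 + b 0 * a 1 * b 1 ^ 3 * a 2 * b 2 * x +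
          p 3 * b 1 * b 3 * x) * h1_3 + (p 3) * h12_34 +
          (a 0 * b 0 ^ 2 * a 1 ^ 2 * b 1 ^ 3 * a 2) * h1_2)
  have h1_34 : t 0 * p 2 = b 3 * a 3 * t 3 ^ 2 + y * b 1 * b 0 * b 3 * t 3 +
        x * b 1 ^ 2 * a 1 * b 0 ^ 2 * b 3 + a 2 * b 1 ^ 2 * a 1 * b 0 * t 2 :=
    hu.mul_left_cancel (by
      linear_combination
        (t 0) * h12_34 + (-t 3 * a 3 * b 3) * h4_12 + (t 2 * a 1 * b 1 ^ 2 * a 2 +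
          b 0 * a 1 * b 1 ^ 2 * b 3 * x + t 3 * b 1 * b 3 * y) * h1_2 +
          (t 0 * b 1 * b 3 * x) * h1_3 + (-a 1 * b 1 ^ 2 * a 2 * b 2 * a 3 * b 3) * h2_4)
  have h2_34 : t 1 * p 2 = b 1 * a 2 * t 2 ^ 2 + x * b 3 * b 0 * b 1 * t 2 +
        y * b 3 ^ 2 * a 0 * b 0 ^ 2 * b 1 + a 3 * b 3 ^ 2 * a 0 * b 0 * t 3 :=
    hu.mul_left_cancel (by
      linear_combination
        (t 1) * h12_34 + (t 3 * a 0 * a 3 * b 3 ^ 2 + t 2 * b 1 * b 3 * x +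
          a 0 * b 0 * b 1 * b 3 ^ 2 * y) * h1_2 + (-t 2 * b 1 * a 2) * h3_12 +
          (t 1 * b 1 * b 3 * y) * h2_4 + (-a 0 * b 1 * a 2 * b 2 * a 3 * b 3 ^ 2) * h1_3)
  have h3_41 : t 2 * p 3 = b 2 * a 3 * t 3 ^ 2 + y * b 0 * b 1 * b 2 * t 3 +
        x * b 0 ^ 2 * a 1 * b 1 ^ 2 * b 2 + a 0 * b 0 ^ 2 * a 1 * b 1 * t 0 :=
    hu.mul_left_cancel (by
      linear_combination
        (-t 3 * b 2 * a 3) * h4_12 + (t 0 * a 0 * b 0 * a 1 * b 1 +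
          b 0 * a 1 * b 1 ^ 2 * b 2 * x + t 3 * b 1 * b 2 * y) * h1_2 +
          (-a 1 * b 1 ^ 2 * a 2 * b 2 ^ 2 * a 3 - t 0 * b 1 * b 2 * y) * h2_4 + (t 2) * h41_12 +
          (t 0 ^ 2 * a 0 + t 0 * b 1 * b 2 * x) * h1_3)
  have h4_23 : t 3 * p 1 = b 2 * a 2 * t 2 ^ 2 + x * b 0 * b 3 * b 2 * t 2 +
        y * b 0 ^ 2 * a 0 * b 3 ^ 2 * b 2 + a 1 * b 0 ^ 2 * a 0 * b 3 * t 1 :=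
    hu.mul_left_cancel (by
      linear_combination
        (-t 2 * a 2 * b 2 - b 0 * b 2 * b 3 * x) * h3_12 + (t 1 * b 2 * b 3 * y +
          t 1 ^ 2 * a 1 + b 2 ^ 2 * a 3 * b 3 ^ 2 * x) * h2_4 + (a 0 * b 0 * b 2 * b 3 ^ 2 * y +
          t 1 * a 0 * b 0 * a 1 * b 3) * h1_2 + (t 3) * h12_23 +
          (-a 0 * a 2 * b 2 ^ 2 * a 3 * b 3 ^ 2) * h1_3)
  have h23_41 : p 1 * p 3 = a 2 * b 2 ^ 2 * a 3 * t 2 * t 3 + b 0 * b 2 * (y * t 1 * t 3 +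
        x * t 2 * t 0) + a 0 * b 0 ^ 2 * a 1 * t 0 * t 1 +
        b 1 * b 2 ^ 2 * b 3 * b 0 ^ 2 * (a 1 * a 2 * a 3 * a 0 - y * x) :=
    hu.mul_left_cancel (by
      linear_combination
        (p 3) * h12_23 + (-t 3 * a 2 * b 2 ^ 2 * a 3 - t 0 * b 0 * b 2 * x) * h3_12 +
          (-t 1 * b 0 * b 2 * y + b 0 * b 2 ^ 2 * a 3 * b 3 * x) * h4_12 + (t 1 ^ 2 * a 1 +
          t 1 * b 2 * b 3 * y) * h2_41 + (t 0 * t 1 * a 0 * b 0 * a 1 +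
          a 0 * b 0 * a 1 * b 1 * a 2 * b 2 ^ 2 * a 3 * b 3 -
          b 0 * b 1 * b 2 ^ 2 * b 3 * x * y + t 3 * b 2 ^ 2 * a 3 * b 3 * x) * h1_2 +
          (-t 1 * b 2 ^ 2 * a 3 * b 3 * x - a 0 * a 2 * b 2 ^ 3 * a 3 ^ 2 * b 3 ^ 2) * h4_1)
  have h3_1 : t 2 * t 0 = b 2 * a 3 * b 3 * t 3 + y * b 2 * b 3 * b 0 * b 1 +
        b 0 * a 1 * b 1 * t 1 := by
    linear_combination h1_3
  have h4_2 : t 3 * t 1 = b 3 * a 0 * b 0 * t 0 + x * b 3 * b 0 * b 1 * b 2 +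
        b 1 * a 2 * b 2 * t 2 := by
    linear_combination h2_4
  have h34_12 : p 2 * p 0 = a 3 * b 3 ^ 2 * a 0 * t 3 * t 0 + b 1 * b 3 * (x * t 2 * t 0 +
        y * t 3 * t 1) + a 1 * b 1 ^ 2 * a 2 * t 1 * t 2 +
        b 2 * b 3 ^ 2 * b 0 * b 1 ^ 2 * (a 2 * a 3 * a 0 * a 1 - x * y) := by
    linear_combination h12_34
  have h41_23 : p 3 * p 1 = a 0 * b 0 ^ 2 * a 1 * t 0 * t 1 + b 2 * b 0 * (y * t 3 * t 1 +
        x * t 0 * t 2) + a 2 * b 2 ^ 2 * a 3 * t 2 * t 3 +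
        b 3 * b 0 ^ 2 * b 1 * b 2 ^ 2 * (a 3 * a 0 * a 1 * a 2 - y * x) := by
    linear_combination h23_41
  constructor <;> intro s <;> fin_cases s
  exacts [h1_2, h2_3, h3_4, h4_1, h12_23, h23_34, h34_41, h41_12, h1_23, h2_34, h3_41, h4_12, h1_34,
      h2_41, h3_12, h4_23, h1_3, h2_4, h3_1, h4_2, h12_34, h23_41, h34_12, h41_23]

end IsG2Point

theorem dih_false (s : Fin 4) : dih s false = ![s, s + 3, s + 2, s + 1] := by
  funext t
  fin_cases s <;> fin_cases t <;> rfl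

theorem lam_two : lam 2 = lam 0 := rfl

theorem lam_three : lam 3 = lam 1 := rfl

theorem f1_true (s : Fin 4) : f1 s true =
    th s * th (s + 1) - (aP s * thp s +
      aP (s + 1) * aS (s + 2) * aP (s + 2) ^ 2 * aS (s + 3) * aP (s + 3)) := by
  fin_cases s <;> simp [f1, dih, thpp, aPP] <;> ring

theorem f2_true (s : Fin 4) : f2 s true =
    thp s * thp (s + 1) - (aS (s + 1) * th (s + 1) ^ 3 +
      lam (s + 1) * aP (s + 2) * aP (s + 3) * th (s + 1) ^ 2 +
      lam s * aP (s + 2) ^ 2 * aS (s + 3) * aP (s + 3) ^ 2 * th (s + 1) +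
      aS (s + 2) * aP (s + 2) ^ 3 * aS (s + 3) ^ 2 * aP (s + 3) ^ 3 * aS s) := by
  fin_cases s <;> simp [f2, dih, thpp, aPP] <;> ring

theorem f3_true (s : Fin 4) : f3 s true =
    th s * thp (s + 1) - (aP s * aS (s + 1) * th (s + 1) ^ 2 +
      lam (s + 1) * aP (s + 2) * aP (s + 3) * aP s * th (s + 1) +
      lam s * aP (s + 2) ^ 2 * aS (s + 3) * aP (s + 3) ^ 2 * aP s +
      aS (s + 2) * aP (s + 2) ^ 2 * aS (s + 3) * aP (s + 3) * th (s + 2)) := by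
  fin_cases s <;> simp [f3, dih, thpp, aPP] <;> ring

theorem f3_false (s : Fin 4) : f3 s false =
    th s * thp (s + 2) - (aP (s + 3) * aS (s + 3) * th (s + 3) ^ 2 +
      lam (s + 3) * aP (s + 1) * aP s * aP (s + 3) * th (s + 3) +
      lam s * aP (s + 1) ^ 2 * aS (s + 1) * aP s ^ 2 * aP (s + 3) +
      aS (s + 2) * aP (s + 1) ^ 2 * aS (s + 1) * aP s * th (s + 2)) := by
  fin_cases s <;> simp [f3, dih_false, thpp, aPP] <;> ring

theorem f4_true (s : Fin 4) : f4 s true =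
    th s * th (s + 2) - (aP s * aS (s + 1) * aP (s + 1) * th (s + 1) +
      lam (s + 1) * aP s * aP (s + 1) * aP (s + 2) * aP (s + 3) +
      aP (s + 2) * aS (s + 3) * aP (s + 3) * th (s + 3)) := by
  fin_cases s <;> simp [f4, dih, aPP] <;> ring

theorem f5_true (s : Fin 4) : f5 s true =
    thp s * thp (s + 2) -
      (aS (s + 1) * aP (s + 1) ^ 2 * aS (s + 2) * th (s + 1) * th (s + 2) +
      aP (s + 3) * aP (s + 1) * (lam s * th s * th (s + 2) +
      lam (s + 1) * th (s + 1) * th (s + 3)) +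
      aS (s + 3) * aP (s + 3) ^ 2 * aS s * th (s + 3) * th s +
      aP s * aP (s + 1) ^ 2 * aP (s + 2) * aP (s + 3) ^ 2 *
      (aS s * aS (s + 1) * aS (s + 2) * aS (s + 3) - lam s * lam (s + 1))) := by
  fin_cases s <;> simp [f5, dih, thpp, aPP] <;> ring

theorem f1_false (s : Fin 4) : f1 s false = f1 (s + 3) true := by
  rw [f1_true]
  fin_cases s <;> simp [f1, dih_false, thpp, aPP] <;> ring

theorem f2_false (s : Fin 4) : f2 s false = f2 (s + 2) true := by
  rw [f2_true]
  fin_cases s <;> simp [f2, dih_false, thpp, aPP, lam_two, lam_three] <;> ring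

theorem f4_false (s : Fin 4) : f4 s false = f4 (s + 2) true := by
  rw [f4_true]
  fin_cases s <;> simp [f4, dih_false, aPP, lam_two, lam_three] <;> ring

theorem f5_false (s : Fin 4) : f5 s false = f5 (s + 3) true := by
  rw [f5_true]
  fin_cases s <;> simp [f5, dih_false, thpp, aPP, lam_two, lam_three] <;> ring

theorem lam_add_two (s : Fin 4) : lam (s + 2) = lam s := by
  fin_cases s <;> rfl

theorem lam_add_three (s : Fin 4) : lam (s + 3) = lam (s + 1) := by
  fin_cases s <;> rfl

theorem lam_rotate {K : Type*} [CommRing K] (φ : R18 →+* K) (s : Fin 4) :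
    (fun r => φ (lam (s + r))) =
      ![φ (lam s), φ (lam (s + 1)), φ (lam s), φ (lam (s + 1))] := by
  funext r
  fin_cases s <;> fin_cases r <;> rfl

theorem genG2_mem_IG2 (m : Fin 5) (s : Fin 4) (d : Bool) : genG2 m s d ∈ IG2 :=
  Ideal.subset_span ⟨(m, s, d), rfl⟩

/-- A ring homomorphism whose values, rotated by `s`, satisfy the G₂ relations
kills all the generators of the G₂ cluster ideal. -/
theorem IsG2Point.map_genG2 {K : Type*} [CommRing K] {φ : R18 →+* K} {s : Fin 4}
    (h : IsG2Point (fun r => φ (th (s + r))) (fun r => φ (thp (s + r)))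
      (fun r => φ (aS (s + r))) (fun r => φ (aP (s + r))) (fun r => φ (lam (s + r))))
    (m : Fin 5) (r : Fin 4) (d : Bool) : φ (genG2 m r d) = 0 := by
  have h1 (r : Fin 4) : φ (f1 r true) = 0 := by
    simpa [f1_true, sub_eq_zero, ← add_assoc] using h.one (r - s)
  have h2 (r : Fin 4) : φ (f2 r true) = 0 := by
    simpa [f2_true, sub_eq_zero, ← add_assoc] using h.two (r - s)
  have h3 (r : Fin 4) : φ (f3 r true) = 0 := by
    simpa [f3_true, sub_eq_zero, ← add_assoc] using h.three (r - s)
  have h3' (r : Fin 4) : φ (f3 r false) = 0 := by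
    simpa [f3_false, sub_eq_zero, ← add_assoc] using h.three_rev (r - s)
  have h4 (r : Fin 4) : φ (f4 r true) = 0 := by
    simpa [f4_true, sub_eq_zero, ← add_assoc] using h.four (r - s)
  have h5 (r : Fin 4) : φ (f5 r true) = 0 := by
    simpa [f5_true, sub_eq_zero, ← add_assoc] using h.five (r - s)
  fin_cases m <;> cases d <;>
    simp [genG2, f1_false, f2_false, f4_false, f5_false, h1, h2, h3, h3', h4, h5]

/-- If six elements of `IG2` generate all the relations over every ring in which `x` becomes
invertible, then they generate the extension of `IG2` to the localization away from `x`. -/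
theorem map_IG2_eq_span {x : R18} {g : Fin 6 → R18} (hg : ∀ i, g i ∈ IG2)
    (H : ∀ {K : Type} [CommRing K] (φ : R18 →+* K), IsUnit (φ x) → (∀ i, φ (g i) = 0) →
      ∀ m s d, φ (genG2 m s d) = 0) :
    Ideal.map (algebraMap R18 (Localization.Away x)) IG2 =
      Ideal.span (Set.range fun i => algebraMap R18 (Localization.Away x) (g i)) := by
  set J := Ideal.span (Set.range fun i => algebraMap R18 (Localization.Away x) (g i)) with hJ
  apply le_antisymm
  · rw [IG2, Ideal.map_span, Ideal.span_le]
    rintro _ ⟨_, ⟨⟨m, s, d⟩, rfl⟩, rfl⟩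
    refine Ideal.Quotient.eq_zero_iff_mem.mp
      (H ((Ideal.Quotient.mk J).comp (algebraMap R18 (Localization.Away x))) ?_ ?_ m s d)
    · exact (IsLocalization.Away.algebraMap_isUnit x).map (Ideal.Quotient.mk J)
    · exact fun i => Ideal.Quotient.eq_zero_iff_mem.mpr (Ideal.subset_span ⟨i, rfl⟩)
  · rw [hJ, Ideal.span_le]
    rintro _ ⟨i, rfl⟩
    exact Ideal.mem_map_of_mem _ (hg i)

theorem map_IG2_away_th (s : Fin 4) : ∃ g : Fin 6 → Localization.Away (th s),
    Ideal.map (algebraMap R18 (Localization.Away (th s))) IG2 = Ideal.span (Set.range g) := by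
  refine ⟨_, map_IG2_eq_span (g := ![f1 s true, f1 (s + 3) true, f3 s true, f3 s false, f4 s true,
    f2 (s + 3) true]) ?_ fun φ hu h => IsG2Point.map_genG2 (s := s) ?_⟩
  · intro i
    fin_cases i
    exacts [genG2_mem_IG2 0 s true, genG2_mem_IG2 0 (s + 3) true, genG2_mem_IG2 2 s true,
      genG2_mem_IG2 2 s false, genG2_mem_IG2 3 s true, genG2_mem_IG2 1 (s + 3) true]
  · rw [lam_rotate]
    apply IsG2Point.of_isUnit_t
    · simpa using hu
    · simpa [f1_true, sub_eq_zero, add_assoc, lam_add_two, lam_add_three] using h 0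
    · simpa [f1_true, sub_eq_zero, add_assoc, lam_add_two, lam_add_three] using h 1
    · simpa [f3_true, sub_eq_zero, add_assoc, lam_add_two, lam_add_three] using h 2
    · simpa [f3_false, sub_eq_zero, add_assoc, lam_add_two, lam_add_three] using h 3
    · simpa [f4_true, sub_eq_zero, add_assoc, lam_add_two, lam_add_three] using h 4
    · simpa [f2_true, sub_eq_zero, add_assoc, lam_add_two, lam_add_three] using h 5

theorem map_IG2_away_thp (s : Fin 4) : ∃ g : Fin 6 → Localization.Away (thp s),
    Ideal.map (algebraMap R18 (Localization.Away (thp s))) IG2 = Ideal.span (Set.range g) := by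
  refine ⟨_, map_IG2_eq_span (g := ![f2 s true, f2 (s + 3) true, f1 s true, f3 (s + 2) false,
    f3 (s + 3) true, f5 s true]) ?_ fun φ hu h => IsG2Point.map_genG2 (s := s) ?_⟩
  · intro i
    fin_cases i
    exacts [genG2_mem_IG2 1 s true, genG2_mem_IG2 1 (s + 3) true, genG2_mem_IG2 0 s true,
      genG2_mem_IG2 2 (s + 2) false, genG2_mem_IG2 2 (s + 3) true, genG2_mem_IG2 4 s true]
  · rw [lam_rotate]
    apply IsG2Point.of_isUnit_p
    · simpa using hu
    · simpa [f2_true, sub_eq_zero, add_assoc, lam_add_two, lam_add_three] using h 0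
    · simpa [f2_true, sub_eq_zero, add_assoc, lam_add_two, lam_add_three] using h 1
    · simpa [f1_true, sub_eq_zero, add_assoc, lam_add_two, lam_add_three] using h 2
    · simpa [f3_false, sub_eq_zero, add_assoc, lam_add_two, lam_add_three] using h 3
    · simpa [f3_true, sub_eq_zero, add_assoc, lam_add_two, lam_add_three] using h 4
    · simpa [f5_true, sub_eq_zero, add_assoc, lam_add_two, lam_add_three] using h 5

/-- For each of the eight cluster variables θ, the extension of `IG2` in the
localization of `R18` away from θ is generated by six elements; that is, on each open set
`(θ ≠ 0)` the cluster variety `X_{G₂}` is a complete intersection of codimension 6. -/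
theorem IG2_localization_CI (t : Fin 8) :
    ∃ g : Fin 6 → Localization.Away (clusterVar t),
      Ideal.map (algebraMap R18 (Localization.Away (clusterVar t))) IG2 =
        Ideal.span (Set.range g) := by
  fin_cases t
  exacts [map_IG2_away_th 0, map_IG2_away_thp 0, map_IG2_away_th 1, map_IG2_away_thp 1,
    map_IG2_away_th 2, map_IG2_away_thp 2, map_IG2_away_th 3, map_IG2_away_thp 3]
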